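/- For 0<q<1, n>m+2 (m a positive integer), and x in [0,1], the m-th order moments D^q_{n,m}(x) = D_{n,q}(t^m;x) of the q-Durrmeyer operator satisfy D^q_{n,0}(x)=1 and the recurrence relation [n+m+2]_q · D^q_{n,m+1}(x) = ([m+1]_q + q^{m+1} x [n]_q) · D^q_{n,m}(x) + x(1-x) q^{m+1} · D_q(D^q_{n,m})(x), where D_q denotes the q-derivative D_q g(x) = (g(qx)-g(x))/((q-1)x) for x≠0. -/

import Mathlib

open Finset Filter Topology

/-- The q-integer `[n]_q = 1 + q + ⋯ + q^(n-1)`. -/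
noncomputable def qInt (q : ℝ) (n : ℕ) : ℝ := ∑ i ∈ Finset.range n, q ^ i

/-- The q-factorial `[n]_q!`. -/
noncomputable def qFact (q : ℝ) (n : ℕ) : ℝ := ∏ i ∈ Finset.range n, qInt q (i + 1)

/-- The q-binomial coefficient. -/
noncomputable def qBinom (q : ℝ) (n k : ℕ) : ℝ := qFact q n / (qFact q k * qFact q (n - k))

/-- `(1 - x)_q^n = ∏_{j=0}^{n-1} (1 - q^j x)`. -/
noncomputable def qOneSubPow (q x : ℝ) (n : ℕ) : ℝ := ∏ j ∈ Finset.range n, (1 - q ^ j * x)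

/-- The q-Bernstein basis `p_{nk}(q;x)`. -/
noncomputable def qBern (q : ℝ) (n k : ℕ) (x : ℝ) : ℝ :=
  qBinom q n k * x ^ k * qOneSubPow q x (n - k)

/-- The Jackson q-integral on `[0,1]`. -/
noncomputable def qIntegral (q : ℝ) (g : ℝ → ℝ) : ℝ := (1 - q) * ∑' j : ℕ, q ^ j * g (q ^ j)

/-- The q-Durrmeyer operator `D_{n,q}(f;x)`. -/
noncomputable def qDurrmeyer (q : ℝ) (n : ℕ) (f : ℝ → ℝ) (x : ℝ) : ℝ :=
  qInt q (n + 1) * ∑ k ∈ Finset.range (n + 1),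
    q ^ (-(k : ℤ)) * qBern q n k x * qIntegral q (fun t => f t * qBern q n k (q * t))

/-- The q-Durrmeyer–Stancu operator `D_{n,q}^{α,β}(f;x)`. -/
noncomputable def qDurrmeyerStancu (q : ℝ) (n : ℕ) (α β : ℝ) (f : ℝ → ℝ) (x : ℝ) : ℝ :=
  qDurrmeyer q n (fun t => f ((qInt q n * t + α) / (qInt q n + β))) x

/-- The q-derivative `D_q f(x) = (f(qx) - f(x)) / ((q-1)x)`. -/
noncomputable def qDeriv (q : ℝ) (f : ℝ → ℝ) (x : ℝ) : ℝ := (f (q * x) - f x) / ((q - 1) * x)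

/-- The q-power `(t - x)_q^m = ∏_{j=0}^{m-1} (t - q^j x)`, as a function of `t`. -/
noncomputable def qCentral (q x : ℝ) (m : ℕ) (t : ℝ) : ℝ := ∏ j ∈ Finset.range m, (t - q ^ j * x)

theorem qInt_pos {q : ℝ} (hq : 0 < q) (n : ℕ) : 0 < qInt q (n + 1) :=
  Finset.sum_pos (fun i _ => pow_pos hq i) ⟨0, by simp⟩

theorem qInt_add (q : ℝ) (a b : ℕ) : qInt q (a + b) = qInt q a + q ^ a * qInt q b := by
  simp only [qInt, Finset.sum_range_add, Finset.mul_sum, pow_add]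

theorem qInt_mul_one_sub (q : ℝ) (n : ℕ) : qInt q n * (1 - q) = 1 - q ^ n :=
  geom_sum_mul_neg q n

theorem qFact_succ (q : ℝ) (n : ℕ) : qFact q (n + 1) = qFact q n * qInt q (n + 1) :=
  Finset.prod_range_succ _ _

theorem qFact_zero (q : ℝ) : qFact q 0 = 1 :=
  Finset.prod_range_zero _

theorem qFact_pos {q : ℝ} (hq : 0 < q) (n : ℕ) : 0 < qFact q n :=
  Finset.prod_pos fun i _ => qInt_pos hq i

theorem qOneSubPow_zero (q x : ℝ) : qOneSubPow q x 0 = 1 :=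
  Finset.prod_range_zero _

theorem qOneSubPow_succ (q x : ℝ) (n : ℕ) :
    qOneSubPow q x (n + 1) = qOneSubPow q x n * (1 - q ^ n * x) :=
  Finset.prod_range_succ _ _

theorem one_sub_mul_qOneSubPow (q x : ℝ) (n : ℕ) :
    (1 - x) * qOneSubPow q (q * x) n = qOneSubPow q x n * (1 - q ^ n * x) := by
  rw [← qOneSubPow_succ, qOneSubPow, qOneSubPow, Finset.prod_range_succ', mul_comm]
  simp [pow_succ, mul_assoc]

/-- The q-Pascal rule. -/
theorem qBinom_succ_succ {q : ℝ} (hq : 0 < q) (a b : ℕ) :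
    qBinom q (a + b + 2) (a + 1) =
      qBinom q (a + b + 1) (a + 1) + q ^ (b + 1) * qBinom q (a + b + 1) a := by
  have ha := (qFact_pos hq a).ne'
  have hb := (qFact_pos hq b).ne'
  have ha' := (qInt_pos hq a).ne'
  have hb' := (qInt_pos hq b).ne'
  have h : qInt q (a + b + 2) = qInt q (b + 1) + q ^ (b + 1) * qInt q (a + 1) := by
    rw [← qInt_add]; congr 1; ring
  simp only [qBinom, show a + b + 2 - (a + 1) = b + 1 by omega,
    show a + b + 1 - (a + 1) = b by omega, show a + b + 1 - a = b + 1 by omega,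
    qFact_succ q (a + b + 1), qFact_succ q a, qFact_succ q b, h]
  field_simp

theorem qBinom_zero_right {q : ℝ} (hq : 0 < q) (n : ℕ) : qBinom q n 0 = 1 := by
  simp [qBinom, qFact_zero, (qFact_pos hq n).ne']

theorem qBinom_self {q : ℝ} (hq : 0 < q) (n : ℕ) : qBinom q n n = 1 := by
  simp [qBinom, qFact_zero, (qFact_pos hq n).ne']

theorem sum_range_qBern_succ {q : ℝ} (hq : 0 < q) (x : ℝ) {n j : ℕ} (hj : j ≤ n) :
    ∑ k ∈ Finset.range (j + 1), qBern q (n + 1) k x =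
      ∑ k ∈ Finset.range j, qBern q n k x +
        qBinom q n j * x ^ j * qOneSubPow q x (n + 1 - j) := by
  induction j with
  | zero => simp [qBern, qBinom_zero_right hq]
  | succ j ih =>
    obtain ⟨b, rfl⟩ : ∃ b, n = j + b + 1 := ⟨n - (j + 1), by omega⟩
    rw [Finset.sum_range_succ, ih (by omega), Finset.sum_range_succ]
    have h := qBinom_succ_succ hq j b
    simp only [qBern, show j + b + 1 + 1 - j = b + 1 + 1 by omega,
      show j + b + 1 + 1 - (j + 1) = b + 1 by omega, show j + b + 1 - j = b + 1 by omega, h,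
      qOneSubPow_succ q x (b + 1)]
    ring

/-- The q-Bernstein polynomials form a partition of unity. -/
theorem sum_qBern {q : ℝ} (hq : 0 < q) (n : ℕ) (x : ℝ) :
    ∑ k ∈ Finset.range (n + 1), qBern q n k x = 1 := by
  induction n with
  | zero => simp [qBern, qBinom_self hq, qOneSubPow_zero]
  | succ n ih =>
    rw [Finset.sum_range_succ, sum_range_qBern_succ hq x le_rfl, ← ih, Finset.sum_range_succ]
    simp [qBern, qBinom_self hq, qOneSubPow_succ, qOneSubPow_zero]
    ring

/-- The q-beta integral as a convergent series. -/
theorem hasSum_qBeta {q : ℝ} (hq0 : 0 < q) (hq1 : q < 1) (a b : ℕ) :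
    HasSum (fun j : ℕ => q ^ j * ((q ^ j) ^ a * qOneSubPow q (q * q ^ j) b))
      ((1 - q)⁻¹ * (qFact q a * qFact q b / qFact q (a + b + 1))) := by
  induction b generalizing a with
  | zero =>
    have h := hasSum_geometric_of_lt_one (pow_nonneg hq0.le (a + 1))
      (pow_lt_one₀ hq0.le hq1 a.succ_ne_zero)
    convert h using 1
    · ext j
      rw [qOneSubPow_zero, ← pow_mul, mul_one, ← pow_add, ← pow_mul]
      congr 1; ring
    · have ha := (qFact_pos hq0 a).ne'
      rw [add_zero, qFact_zero, qFact_succ, ← qInt_mul_one_sub]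
      field_simp
  | succ b ih =>
    have h : qInt q (a + b + 1 + 1) = qInt q (b + 1) + q ^ (b + 1) * qInt q (a + 1) := by
      rw [← qInt_add]; congr 1; ring
    have hp := (qFact_pos hq0 (a + b + 1)).ne'
    have hi := (qInt_pos hq0 (a + b + 1)).ne'
    have hq : 1 - q ≠ 0 := (sub_pos.2 hq1).ne'
    have hval : (1 - q)⁻¹ * (qFact q a * qFact q (b + 1) / qFact q (a + (b + 1) + 1)) =
        (1 - q)⁻¹ * (qFact q a * qFact q b / qFact q (a + b + 1)) - q ^ (b + 1) *
          ((1 - q)⁻¹ * (qFact q (a + 1) * qFact q b / qFact q (a + 1 + b + 1))) := by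
      rw [show a + (b + 1) + 1 = a + b + 1 + 1 by ring, show a + 1 + b + 1 = a + b + 1 + 1 by ring,
        qFact_succ q (a + b + 1), qFact_succ q a, qFact_succ q b]
      field_simp
      linear_combination -qFact q a * qFact q b * h
    rw [hval]
    have hfun : (fun j : ℕ => q ^ j * ((q ^ j) ^ a * qOneSubPow q (q * q ^ j) (b + 1))) =
        fun j : ℕ => q ^ j * ((q ^ j) ^ a * qOneSubPow q (q * q ^ j) b) - q ^ (b + 1) *
          (q ^ j * ((q ^ j) ^ (a + 1) * qOneSubPow q (q * q ^ j) b)) := by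
      ext j
      rw [qOneSubPow_succ]
      ring
    rw [hfun]
    exact (ih a).sub ((ih (a + 1)).mul_left (q ^ (b + 1)))

theorem qIntegral_pow_mul_qBern {q : ℝ} (hq0 : 0 < q) (hq1 : q < 1) (m : ℕ) {n k : ℕ}
    (hk : k ≤ n) :
    qIntegral q (fun t => t ^ m * qBern q n k (q * t)) =
      q ^ k * (qFact q n * qFact q (k + m) / (qFact q k * qFact q (n + m + 1))) := by
  have h := (hasSum_qBeta hq0 hq1 (k + m) (n - k)).mul_left (qBinom q n k * q ^ k)
  rw [show k + m + (n - k) + 1 = n + m + 1 by omega] at h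
  have hs : (fun j : ℕ => q ^ j * ((q ^ j) ^ m * qBern q n k (q * q ^ j))) = fun j : ℕ =>
      qBinom q n k * q ^ k *
        (q ^ j * ((q ^ j) ^ (k + m) * qOneSubPow q (q * q ^ j) (n - k))) := by
    ext j
    rw [qBern]
    ring
  have hq : 1 - q ≠ 0 := (sub_pos.2 hq1).ne'
  have hf := (qFact_pos hq0 (n - k)).ne'
  rw [qIntegral, hs, h.tsum_eq, qBinom]
  field_simp

theorem qDurrmeyer_pow {q : ℝ} (hq0 : 0 < q) (hq1 : q < 1) (n m : ℕ) (x : ℝ) :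
    qDurrmeyer q n (fun t => t ^ m) x =
      qFact q (n + 1) / qFact q (n + m + 1) * ∑ k ∈ Finset.range (n + 1),
        qFact q (k + m) / qFact q k * qBern q n k x := by
  rw [qDurrmeyer, qFact_succ, Finset.mul_sum, Finset.mul_sum]
  refine Finset.sum_congr rfl fun k hk => ?_
  rw [qIntegral_pow_mul_qBern hq0 hq1 m (Nat.lt_succ_iff.1 (Finset.mem_range.1 hk)),
    zpow_neg, zpow_natCast]
  have hf := (qFact_pos hq0 k).ne'
  field_simp

theorem one_sub_mul_qBern_sub (q x : ℝ) {n k : ℕ} (hk : k ≤ n) :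
    (1 - x) * (qBern q n k (q * x) - qBern q n k x) =
      (q - 1) * ((qInt q k - qInt q n * x) * qBern q n k x) := by
  have h := one_sub_mul_qOneSubPow q x (n - k)
  have hp : q ^ n = q ^ k * q ^ (n - k) := by rw [← pow_add, Nat.add_sub_cancel' hk]
  have h1 := qInt_mul_one_sub q n
  have h2 := qInt_mul_one_sub q k
  rw [hp] at h1
  simp only [qBern, mul_pow]
  linear_combination qBinom q n k * q ^ k * x ^ k * h +
    qBinom q n k * x ^ k * qOneSubPow q x (n - k) * (h2 - x * h1)

theorem mul_qDeriv_sum_qBern {q : ℝ} (hq : q ≠ 1) (n : ℕ) (c : ℕ → ℝ) (A x : ℝ) :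
    x * (1 - x) *
        qDeriv q (fun y => A * ∑ k ∈ Finset.range (n + 1), c k * qBern q n k y) x =
      A * ∑ k ∈ Finset.range (n + 1), c k * ((qInt q k - qInt q n * x) * qBern q n k x) := by
  have hq' : q - 1 ≠ 0 := sub_ne_zero.2 hq
  rcases eq_or_ne x 0 with rfl | hx
  · have h (k : ℕ) : c k * ((qInt q k - qInt q n * 0) * qBern q n k 0) = 0 := by
      cases k <;> simp [qInt, qBern]
    rw [Finset.sum_congr rfl fun k _ => h k]
    simp
  · have h : (1 - x) * (∑ k ∈ Finset.range (n + 1), c k * qBern q n k (q * x) -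
        ∑ k ∈ Finset.range (n + 1), c k * qBern q n k x) =
        (q - 1) * ∑ k ∈ Finset.range (n + 1),
          c k * ((qInt q k - qInt q n * x) * qBern q n k x) := by
      rw [← Finset.sum_sub_distrib, Finset.mul_sum, Finset.mul_sum]
      refine Finset.sum_congr rfl fun k hk => ?_
      linear_combination c k *
        one_sub_mul_qBern_sub q x (Nat.lt_succ_iff.1 (Finset.mem_range.1 hk))
    rw [qDeriv, mul_div_assoc', div_eq_iff (mul_ne_zero hq' hx)]
    linear_combination x * A * h

/-- Recurrence relation for the moments of the q-Durrmeyer operator. -/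
theorem qDurrmeyer_moment_recurrence (q : ℝ) (hq0 : 0 < q) (hq1 : q < 1)
    (m : ℕ) (hm : 0 < m) (n : ℕ) (hn : m + 2 < n) (x : ℝ) (hx : x ∈ Set.Icc (0 : ℝ) 1) :
    qDurrmeyer q n (fun t => t ^ 0) x = 1 ∧
    qInt q (n + m + 2) * qDurrmeyer q n (fun t => t ^ (m + 1)) x =
      (qInt q (m + 1) + q ^ (m + 1) * x * qInt q n) * qDurrmeyer q n (fun t => t ^ m) x +
        x * (1 - x) * q ^ (m + 1) *
          qDeriv q (fun y => qDurrmeyer q n (fun t => t ^ m) y) x := by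
  refine ⟨?_, ?_⟩
  · rw [qDurrmeyer_pow hq0 hq1]
    have hk (k : ℕ) : qFact q k / qFact q k = 1 := div_self (qFact_pos hq0 k).ne'
    simp [hk, sum_qBern hq0]
  · have hD : (fun y => qDurrmeyer q n (fun t => t ^ m) y) = _ :=
      funext (qDurrmeyer_pow hq0 hq1 n m)
    rw [hD, mul_right_comm (x * (1 - x)), mul_qDeriv_sum_qBern hq1.ne, qDurrmeyer_pow hq0 hq1,
      qDurrmeyer_pow hq0 hq1, show n + (m + 1) + 1 = n + m + 1 + 1 by ring, qFact_succ q (n + m + 1)]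
    have hi := (qInt_pos hq0 (n + m + 1)).ne'
    have hc : ∑ k ∈ Finset.range (n + 1), qFact q (k + (m + 1)) / qFact q k * qBern q n k x =
        (qInt q (m + 1) + q ^ (m + 1) * x * qInt q n) *
          ∑ k ∈ Finset.range (n + 1), qFact q (k + m) / qFact q k * qBern q n k x +
        q ^ (m + 1) * ∑ k ∈ Finset.range (n + 1),
          qFact q (k + m) / qFact q k * ((qInt q k - qInt q n * x) * qBern q n k x) := by
      rw [Finset.mul_sum, Finset.mul_sum, ← Finset.sum_add_distrib]
      refine Finset.sum_congr rfl fun k _ => ?_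
      rw [← add_assoc, qFact_succ, show k + m + 1 = m + 1 + k by ring, qInt_add]
      ring
    rw [hc, show n + m + 2 = n + m + 1 + 1 by ring]
    field_simp
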